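/- arXiv:2407.11092 — 3 statements merged into one kernel-verified Lean document; each statement's English description precedes it below -/
import Mathlib

section
/- Let Γ be a finite simple graph on m vertices with a fixed linear order on its edge set, and let B be a bond partition of Γ with blocks B_1,…,B_k; for each i let Γ_i denote the induced subgraph of Γ on B_i, with the induced edge order. Then the Möbius function of the bond lattice Π_Γ satisfies μ(⊥, B) = (−1)^{m−k} · ∏_{i=1}^k a_1(Γ_i). -/
/-!
STATEMENT 9: For a finite simple graph Γ on m vertices with a linear edge order
and a bond partition B with blocks B_1,…,B_k, the Möbius function of the bond
lattice Π_Γ satisfies μ(⊥, B) = (−1)^{m−k} ∏ a_1(Γ_i), where Γ_i is the induced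
subgraph on B_i (with the induced edge order) and a_1 counts NBC spanning trees.
-/

/-- The edge set of a cycle of the graph `H`. -/
def isCycleEdges {W : Type} [DecidableEq W] (H : SimpleGraph W)
    (C : Finset (Sym2 W)) : Prop :=
  ∃ (v : W) (w : H.Walk v v), w.IsCycle ∧ C = w.edges.toFinset

/-- `B` is a broken circuit of `H` with respect to the edge order `le`. -/
def isBrokenCircuit {W : Type} [DecidableEq W] (H : SimpleGraph W)
    (le : Sym2 W → Sym2 W → Prop) (B : Finset (Sym2 W)) : Prop :=
  ∃ C e, isCycleEdges H C ∧ e ∈ C ∧ (∀ f ∈ C, le f e) ∧ B = C.erase e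

/-- An edge set is NBC if it contains no broken circuit. -/
def isNBC {W : Type} [DecidableEq W] (H : SimpleGraph W)
    (le : Sym2 W → Sym2 W → Prop) (F : Finset (Sym2 W)) : Prop :=
  ∀ B, isBrokenCircuit H le B → ¬ B ⊆ F

/-- A spanning tree of `H`: a set of edges of `H` forming a tree on all vertices. -/
def isSpanningTreeIn {W : Type} (H : SimpleGraph W) (T : Finset (Sym2 W)) : Prop :=
  (↑T : Set (Sym2 W)) ⊆ H.edgeSet ∧
    (SimpleGraph.fromEdgeSet (↑T : Set (Sym2 W))).IsTree

/-- `a1 H le` is the number of spanning trees of `H` containing no broken circuit. -/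
noncomputable def a1 {W : Type} [DecidableEq W] (H : SimpleGraph W)
    (le : Sym2 W → Sym2 W → Prop) : ℕ :=
  Nat.card {T : Finset (Sym2 W) // isSpanningTreeIn H T ∧ isNBC H le T}

/-- A setoid (equivalently, a partition of the vertex set) is a bond partition of
`G` if each of its equivalence classes induces a connected subgraph of `G`. -/
def IsBondPartition {m : ℕ} (G : SimpleGraph (Fin m)) (s : Setoid (Fin m)) : Prop :=
  ∀ c ∈ s.classes, (G.induce c).Connected

/-- The bond lattice of `G`: bond partitions, ordered by refinement
(the `Setoid` order: finer ≤ coarser). -/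
abbrev BondLattice {m : ℕ} (G : SimpleGraph (Fin m)) : Type :=
  {s : Setoid (Fin m) // IsBondPartition G s}

open SimpleGraph

section NBC

variable {V : Type}

theorem rel_of_reachable {H : SimpleGraph V} {s : Setoid V} (h : ∀ a b, H.Adj a b → s a b)
    {a b : V} (hab : H.Reachable a b) : s a b := by
  obtain ⟨w⟩ := hab
  induction w with
  | nil => exact s.refl' _
  | cons hadj _ ih => exact s.trans' (h _ _ hadj) ih

theorem connected_induce_of_mem_classes {H : SimpleGraph V} {c : Set V}
    (hc : c ∈ H.reachableSetoid.classes) : (H.induce c).Connected := by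
  obtain ⟨y, rfl⟩ := hc
  have : {x | H.reachableSetoid x y} = (H.connectedComponentMk y).supp := by
    ext x
    simp only [ConnectedComponent.mem_supp_iff, ConnectedComponent.eq]
    rfl
  rw [this]
  exact ConnectedComponent.connected_toSimpleGraph _

/-- If all edges of a cycle but one join related vertices, so does the remaining edge. -/
theorem rel_of_mem_edges_isCycle {G : SimpleGraph V} {s : Setoid V} {v : V} {w : G.Walk v v}
    (hw : w.IsCycle) {e : Sym2 V} (h : ∀ a b, s(a, b) ∈ w.edges → s(a, b) ≠ e → s a b)
    {a b : V} (hab : s(a, b) ∈ w.edges) : s a b := by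
  by_cases he : s(a, b) = e
  · subst he
    have hE : ∀ f ∈ w.edges, f ∈ (fromEdgeSet {f | f ∈ w.edges}).edgeSet := fun f hf => by
      rw [edgeSet_fromEdgeSet]
      exact ⟨hf, G.not_isDiag_of_mem_edgeSet (w.edges_subset_edgeSet hf)⟩
    have hbr := fun hb => IsBridge.notMem_edges_of_isCycle hb (hw.transfer hE)
      (by rwa [Walk.edges_transfer])
    rw [isBridge_iff, imp_false, not_not] at hbr
    refine rel_of_reachable (fun x y hxy => ?_) hbr
    rw [deleteEdges_adj, fromEdgeSet_adj] at hxy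
    exact h x y hxy.1.1 hxy.2
  · exact h a b hab he

theorem rel_of_mem_support {G : SimpleGraph V} {s : Setoid V} {u v : V} (w : G.Walk u v)
    (h : ∀ a b, s(a, b) ∈ w.edges → s a b) {x : V} (hx : x ∈ w.support) : s x u := by
  induction w with
  | nil => simp_all
  | cons hadj p ih =>
    rw [Walk.support_cons, List.mem_cons] at hx
    obtain rfl | hx := hx
    · exact s.refl' _
    · exact s.trans' (ih (fun a b hab => h a b (by simp [hab])) hx)
        (s.symm' (h _ _ (by simp)))

theorem exists_forall_rel_of_nonempty {α : Type} (le : α → α → Prop) [IsLinearOrder α le]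
    {S : Finset α} (hS : S.Nonempty) : ∃ e ∈ S, ∀ f ∈ S, le f e := by
  induction hS using Finset.Nonempty.cons_induction with
  | singleton a => exact ⟨a, by simp, by simp [refl_of le a]⟩
  | cons a S ha hS ih =>
    obtain ⟨e, he, hmax⟩ := ih
    obtain h | h := total_of le a e
    · exact ⟨e, by simp [he], by simpa [h] using hmax⟩
    · exact ⟨a, by simp, by
        simpa [refl_of le a] using fun f hf => trans_of le (hmax f hf) h⟩

/-- The edges of `F` with both endpoints in `c`. -/
noncomputable def restrictEdges (c : Set V) (F : Finset (Sym2 V)) : Finset (Sym2 c) :=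
  F.preimage (Sym2.map Subtype.val) (Sym2.map.injective Subtype.val_injective).injOn

theorem mem_restrictEdges {F : Finset (Sym2 V)} {c : Set V} {e : Sym2 c} :
    e ∈ restrictEdges c F ↔ e.map Subtype.val ∈ F :=
  Finset.mem_preimage

theorem fromEdgeSet_restrictEdges {F : Finset (Sym2 V)} (c : Set V) :
    fromEdgeSet (restrictEdges c F : Set (Sym2 c)) =
      (fromEdgeSet (F : Set (Sym2 V))).induce c := by
  ext a b
  simp [mem_restrictEdges, Subtype.ext_iff]

variable [DecidableEq V] {G : SimpleGraph V} {le : Sym2 V → Sym2 V → Prop} {F : Finset (Sym2 V)}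

theorem isNBC.mono {F' : Finset (Sym2 V)} (h : isNBC G le F) (hF : F' ⊆ F) : isNBC G le F' :=
  fun B hB hBF => h B hB (hBF.trans hF)

theorem isBrokenCircuit.nonempty {B : Finset (Sym2 V)} (h : isBrokenCircuit G le B) :
    B.Nonempty := by
  obtain ⟨_, e, ⟨v, w, hw, rfl⟩, he, -, rfl⟩ := h
  rw [← Finset.card_pos, Finset.card_erase_of_mem he,
    List.toFinset_card_of_nodup hw.isTrail.edges_nodup, Walk.length_edges]
  have := hw.three_le_length
  omega

theorem isNBC_empty : isNBC G le ∅ := fun _ hB hB' =>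
  hB.nonempty.ne_empty (Finset.subset_empty.1 hB')

theorem isNBC.isAcyclic [IsLinearOrder (Sym2 V) le] (h : isNBC G le F)
    (hF : (F : Set (Sym2 V)) ⊆ G.edgeSet) :
    (fromEdgeSet (F : Set (Sym2 V))).IsAcyclic := by
  intro v w hw
  have hle : fromEdgeSet (F : Set (Sym2 V)) ≤ G := fun a b hab => hF (fromEdgeSet_adj _ |>.1 hab).1
  have hmem : ∀ e ∈ w.edges, e ∈ F := fun e he => by
    have := w.edges_subset_edgeSet he
    rw [edgeSet_fromEdgeSet] at this
    exact this.1
  have hne : w.edges.toFinset.Nonempty := by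
    rw [← Finset.card_pos, List.toFinset_card_of_nodup hw.isTrail.edges_nodup, Walk.length_edges]
    have := hw.three_le_length
    omega
  obtain ⟨e, he, hmax⟩ := exists_forall_rel_of_nonempty le hne
  refine h _ ⟨_, e, ⟨v, w.mapLe hle, hw.mapLe hle, rfl⟩, ?_, ?_, rfl⟩ fun f hf => ?_
  · simpa using he
  · simpa using hmax
  · exact hmem f (by simpa using Finset.mem_of_mem_erase hf)

/-- Inserting the largest edge joining related vertices keeps an edge set NBC. -/
theorem isNBC.insert_of_max [IsLinearOrder (Sym2 V) le] {s : Setoid V} {E : Finset (Sym2 V)}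
    (hE : ∀ a b, s(a, b) ∈ E ↔ G.Adj a b ∧ s a b) {e : Sym2 V} (he : e ∈ E)
    (hmax : ∀ f ∈ E, le f e) (hF : F ⊆ E) (h : isNBC G le F) : isNBC G le (insert e F) := by
  rintro _ ⟨C, f, ⟨v, w, hw, rfl⟩, hf, hfmax, rfl⟩ hsub
  have hrel : ∀ a b, s(a, b) ∈ w.edges → s a b := fun a b =>
    rel_of_mem_edges_isCycle hw (e := f) fun a b hab hne =>
      ((hE a b).1 (Finset.insert_subset he hF (hsub (by simp [hab, hne])))).2
  have hfE : f ∈ E := by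
    induction f with
    | h a b =>
      rw [List.mem_toFinset] at hf
      exact (hE a b).2 ⟨w.adj_of_mem_edges hf, hrel a b hf⟩
  refine h _ ⟨_, f, ⟨v, w, hw, rfl⟩, hf, hfmax, rfl⟩ fun g hg => ?_
  obtain rfl | hg' := Finset.mem_insert.1 (hsub hg)
  · exact absurd (antisymm_of le (hfmax g (Finset.mem_of_mem_erase hg)) (hmax f hfE))
      (Finset.ne_of_mem_erase hg)
  · exact hg'

open Classical in
theorem sum_neg_one_pow_card_isNBC [IsLinearOrder (Sym2 V) le] {s : Setoid V}
    {E : Finset (Sym2 V)} (hE : ∀ a b, s(a, b) ∈ E ↔ G.Adj a b ∧ s a b) (hne : E.Nonempty) :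
    ∑ F ∈ E.powerset with isNBC G le F, (-1 : ℤ) ^ F.card = 0 := by
  obtain ⟨e, he, hmax⟩ := exists_forall_rel_of_nonempty le hne
  refine Finset.sum_involution (fun F _ => if e ∈ F then F.erase e else insert e F)
    (fun F _ => ?_) (fun F _ _ => ?_) (fun F hF => ?_) (fun F _ => ?_)
  · split_ifs with h
    · rw [← Finset.card_erase_add_one h, pow_succ]
      ring
    · rw [Finset.card_insert_of_notMem h, pow_succ]
      ring
  · split_ifs with h
    · exact fun h' => Finset.erase_eq_self.1 h' h
    · exact fun h' => h (h' ▸ Finset.mem_insert_self e F)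
  · rw [Finset.mem_filter, Finset.mem_powerset] at hF ⊢
    split_ifs with h
    · exact ⟨(Finset.erase_subset _ _).trans hF.1, hF.2.mono (Finset.erase_subset _ _)⟩
    · exact ⟨Finset.insert_subset he hF.1, hF.2.insert_of_max hE he hmax hF.1⟩
  · by_cases h : e ∈ F <;> simp [h]

theorem isBrokenCircuit.image {c : Set V} {B : Finset (Sym2 c)}
    (h : isBrokenCircuit (G.induce c) (fun e f => le (e.map Subtype.val) (f.map Subtype.val)) B) :
    isBrokenCircuit G le (B.image (Sym2.map Subtype.val)) := by
  obtain ⟨_, e, ⟨v, w, hw, rfl⟩, he, hmax, rfl⟩ := h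
  refine ⟨w.edges.toFinset.image (Sym2.map Subtype.val), e.map Subtype.val,
    ⟨v, w.map (Embedding.induce c).toHom, hw.map Subtype.val_injective, ?_⟩,
    Finset.mem_image_of_mem _ he, ?_, ?_⟩
  · ext f
    have h : f ∈ (w.map (Embedding.induce c).toHom).edges ↔
        f ∈ w.edges.map (Sym2.map Subtype.val) := by rw [Walk.edges_map]; rfl
    rw [List.mem_toFinset]
    exact .trans (by simp) h.symm
  · simpa using hmax
  · exact Finset.image_erase (Sym2.map.injective Subtype.val_injective) _ _

/-- A broken circuit whose edges all join related vertices lies in a single class. -/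
theorem isBrokenCircuit.exists_image_eq {s : Setoid V} {B : Finset (Sym2 V)}
    (h : isBrokenCircuit G le B) (hB : ∀ a b, s(a, b) ∈ B → s a b) :
    ∃ c ∈ s.classes, ∃ B' : Finset (Sym2 c),
      isBrokenCircuit (G.induce c) (fun e f => le (e.map Subtype.val) (f.map Subtype.val)) B' ∧
        B'.image (Sym2.map Subtype.val) = B := by
  obtain ⟨_, e, ⟨v, w, hw, rfl⟩, he, hmax, rfl⟩ := h
  have hrel : ∀ a b, s(a, b) ∈ w.edges → s a b := fun a b =>
    rel_of_mem_edges_isCycle hw (e := e) fun a b hab hne => hB a b (by simp [hab, hne])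
  have hsupp : ∀ x ∈ w.support, x ∈ {x | s x v} := fun x => rel_of_mem_support w hrel
  have hmap := w.map_induce (s := {x | s x v}) hsupp
  have hedges : w.edges = (w.induce _ hsupp).edges.map (Sym2.map Subtype.val) :=
    (congrArg Walk.edges hmap).symm.trans (Walk.edges_map ..)
  have hinj : Function.Injective (Sym2.map (Subtype.val : {x | s x v} → V)) :=
    Sym2.map.injective Subtype.val_injective
  obtain ⟨e, he', rfl⟩ : ∃ e' ∈ (w.induce _ hsupp).edges, e'.map Subtype.val = e := by
    simpa only [hedges, List.mem_toFinset, List.mem_map] using he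
  refine ⟨_, s.mem_classes v, _, ⟨_, e, ⟨_, w.induce _ hsupp, ?_, rfl⟩, by simpa using he',
    ?_, rfl⟩, ?_⟩
  · exact Walk.IsCycle.of_map (f := (Embedding.induce _).toHom) (by rwa [hmap])
  · intro f hf
    refine hmax _ ?_
    rw [hedges, List.mem_toFinset]
    exact List.mem_map_of_mem (List.mem_toFinset.1 hf)
  · rw [Finset.image_erase hinj, hedges]
    congr 1
    ext f
    simp

theorem isNBC.restrictEdges (h : isNBC G le F) (c : Set V) :
    isNBC (G.induce c) (fun e f => le (e.map Subtype.val) (f.map Subtype.val))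
      (restrictEdges c F) := fun _ hB hsub =>
  h _ hB.image (Finset.image_subset_iff.2 fun _ he => mem_restrictEdges.1 (hsub he))

theorem isSpanningTreeIn_restrictEdges [IsLinearOrder (Sym2 V) le] (h : isNBC G le F)
    (hF : (F : Set (Sym2 V)) ⊆ G.edgeSet) {c : Set V}
    (hc : c ∈ (fromEdgeSet (F : Set (Sym2 V))).reachableSetoid.classes) :
    isSpanningTreeIn (G.induce c) (_root_.restrictEdges c F) := by
  refine ⟨fun e he => ?_, ?_⟩
  · induction e with
    | h a b => exact hF (mem_restrictEdges.1 he)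
  · rw [fromEdgeSet_restrictEdges]
    exact ⟨connected_induce_of_mem_classes hc, (h.isAcyclic hF).induce c⟩

section Glue

variable {s : Setoid V} [Fintype s.classes]

/-- The union of a family of edge sets on the classes of `s`. -/
def glueEdges (T : ∀ c : s.classes, Finset (Sym2 c.1)) : Finset (Sym2 V) :=
  Finset.univ.biUnion fun c => (T c).image (Sym2.map Subtype.val)

theorem rel_of_mem_glueEdges {T : ∀ c : s.classes, Finset (Sym2 c.1)} {a b : V}
    (h : s(a, b) ∈ glueEdges T) : s a b := by
  obtain ⟨c, -, hc⟩ := Finset.mem_biUnion.1 h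
  obtain ⟨e, -, he⟩ := Finset.mem_image.1 hc
  induction e with
  | h x y =>
    refine s.rel_iff_exists_classes.2 ⟨c, c.2, ?_⟩
    obtain ⟨rfl, rfl⟩ | ⟨rfl, rfl⟩ := Sym2.eq_iff.1 he
    exacts [⟨x.2, y.2⟩, ⟨y.2, x.2⟩]

theorem restrictEdges_glueEdges (T : ∀ c : s.classes, Finset (Sym2 c.1)) (c : s.classes) :
    restrictEdges c.1 (glueEdges T) = T c := by
  ext e
  rw [mem_restrictEdges, glueEdges, Finset.mem_biUnion]
  refine ⟨fun ⟨d, _, hd⟩ => ?_, fun he => ⟨c, Finset.mem_univ _, Finset.mem_image_of_mem _ he⟩⟩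
  obtain ⟨f, hf, hfe⟩ := Finset.mem_image.1 hd
  have hdc : d = c := by
    induction e with
    | h a b =>
      have ha : a.1 ∈ f.map Subtype.val := by rw [hfe]; simp
      obtain ⟨x, -, hx⟩ := Sym2.mem_map.1 ha
      exact Subtype.ext (s.eq_of_mem_classes d.2 (hx ▸ x.2) c.2 a.2)
  subst hdc
  rwa [← Sym2.map.injective Subtype.val_injective hfe]

theorem glueEdges_restrictEdges (h : ∀ a b, s(a, b) ∈ F → s a b) :
    glueEdges (fun c : s.classes => restrictEdges c.1 F) = F := by
  ext e
  rw [glueEdges, Finset.mem_biUnion]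
  constructor
  · rintro ⟨c, -, hc⟩
    obtain ⟨f, hf, rfl⟩ := Finset.mem_image.1 hc
    exact mem_restrictEdges.1 hf
  · induction e with
    | h a b =>
      intro he
      obtain ⟨c, hc, ha, hb⟩ := s.rel_iff_exists_classes.1 (h a b he)
      exact ⟨⟨c, hc⟩, Finset.mem_univ _, Finset.mem_image.2
        ⟨s(⟨a, ha⟩, ⟨b, hb⟩), mem_restrictEdges.2 he, rfl⟩⟩

theorem card_glueEdges (T : ∀ c : s.classes, Finset (Sym2 c.1)) :
    (glueEdges T).card = ∑ c, (T c).card := by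
  rw [glueEdges, Finset.card_biUnion]
  · exact Finset.sum_congr rfl fun c _ =>
      Finset.card_image_of_injective _ (Sym2.map.injective Subtype.val_injective)
  · intro c _ d _ hcd
    refine Finset.disjoint_left.2 fun e hc hd => hcd ?_
    obtain ⟨f, -, rfl⟩ := Finset.mem_image.1 hc
    obtain ⟨g, -, hg⟩ := Finset.mem_image.1 hd
    induction f with
    | h a b =>
      have ha : a.1 ∈ g.map Subtype.val := by rw [hg]; simp
      obtain ⟨x, -, hx⟩ := Sym2.mem_map.1 ha
      exact Subtype.ext (s.eq_of_mem_classes c.2 a.2 d.2 (hx ▸ x.2))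

theorem glueEdges_subset_edgeSet {T : ∀ c : s.classes, Finset (Sym2 c.1)}
    (hT : ∀ c, isSpanningTreeIn (G.induce c.1) (T c)) :
    (glueEdges T : Set (Sym2 V)) ⊆ G.edgeSet := by
  intro e he
  obtain ⟨c, -, hc⟩ := Finset.mem_biUnion.1 he
  obtain ⟨f, hf, rfl⟩ := Finset.mem_image.1 hc
  have := (hT c).1 hf
  induction f with
  | h a b => exact this

theorem reachableSetoid_glueEdges {T : ∀ c : s.classes, Finset (Sym2 c.1)}
    (hT : ∀ c, isSpanningTreeIn (G.induce c.1) (T c)) :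
    (fromEdgeSet (glueEdges T : Set (Sym2 V))).reachableSetoid = s := by
  refine Setoid.ext fun a b => ⟨rel_of_reachable fun x y hxy =>
    rel_of_mem_glueEdges ((fromEdgeSet_adj _).1 hxy).1, fun hab => ?_⟩
  obtain ⟨c, hc, ha, hb⟩ := s.rel_iff_exists_classes.1 hab
  have := (hT ⟨c, hc⟩).2.connected.preconnected ⟨a, ha⟩ ⟨b, hb⟩
  rw [← restrictEdges_glueEdges T, fromEdgeSet_restrictEdges] at this
  exact this.map (Embedding.induce c).toHom

theorem isNBC_glueEdges {T : ∀ c : s.classes, Finset (Sym2 c.1)}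
    (hT : ∀ c, isNBC (G.induce c.1)
      (fun e f => le (e.map Subtype.val) (f.map Subtype.val)) (T c)) :
    isNBC G le (glueEdges T) := by
  intro B hB hsub
  obtain ⟨c, hc, B', hB', rfl⟩ :=
    hB.exists_image_eq (s := s) fun a b hab => rel_of_mem_glueEdges (hsub hab)
  refine hT ⟨c, hc⟩ B' hB' fun e he => ?_
  rw [← restrictEdges_glueEdges T]
  exact mem_restrictEdges.2 (hsub (Finset.mem_image_of_mem _ he))

/-- NBC edge sets whose connected components are the classes of `s` correspond to families of NBC
spanning trees of the classes. -/
noncomputable def nbcForestEquiv (G : SimpleGraph V) (le : Sym2 V → Sym2 V → Prop)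
    [IsLinearOrder (Sym2 V) le] (s : Setoid V) [Fintype s.classes] :
    {F : Finset (Sym2 V) // (F : Set (Sym2 V)) ⊆ G.edgeSet ∧ isNBC G le F ∧
      (fromEdgeSet (F : Set (Sym2 V))).reachableSetoid = s} ≃
    ∀ c : s.classes, {T : Finset (Sym2 c.1) // isSpanningTreeIn (G.induce c.1) T ∧
      isNBC (G.induce c.1) (fun e f => le (e.map Subtype.val) (f.map Subtype.val)) T} where
  toFun F c := ⟨restrictEdges c.1 F.1,
    isSpanningTreeIn_restrictEdges F.2.2.1 F.2.1 (by rw [F.2.2.2]; exact c.2),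
    F.2.2.1.restrictEdges _⟩
  invFun T := ⟨glueEdges fun c => (T c).1, glueEdges_subset_edgeSet fun c => (T c).2.1,
    isNBC_glueEdges fun c => (T c).2.2, reachableSetoid_glueEdges fun c => (T c).2.1⟩
  left_inv F := Subtype.ext <| glueEdges_restrictEdges fun a b hab => by
    rw [← F.2.2.2]
    exact Adj.reachable ((fromEdgeSet_adj _).2 ⟨hab, (F.2.1 hab : G.Adj a b).ne⟩)
  right_inv T := funext fun c => Subtype.ext (restrictEdges_glueEdges _ c)

theorem isSpanningTreeIn.card_add_one {W : Type} [Fintype W] {H : SimpleGraph W}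
    {T : Finset (Sym2 W)} (h : isSpanningTreeIn H T) : T.card + 1 = Fintype.card W := by
  classical
  rw [← h.2.card_edgeFinset]
  congr 2
  ext e
  rw [mem_edgeFinset, edgeSet_fromEdgeSet]
  exact ⟨fun he => ⟨he, H.not_isDiag_of_mem_edgeSet (h.1 he)⟩, fun he => he.1⟩

theorem card_glueEdges_add_card [Fintype V] {T : ∀ c : s.classes, Finset (Sym2 c.1)}
    (hT : ∀ c, isSpanningTreeIn (G.induce c.1) (T c)) :
    (glueEdges T).card + Fintype.card s.classes = Fintype.card V := by
  classical
  rw [card_glueEdges, Fintype.card_eq_sum_ones, ← Finset.sum_add_distrib,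
    Finset.sum_congr rfl fun c _ => (hT c).card_add_one, ← Fintype.card_sigma]
  refine Fintype.card_congr (Equiv.ofBijective (fun x => x.2.1) ⟨?_, fun a => ?_⟩)
  · rintro ⟨c, x⟩ ⟨d, y⟩ (hxy : x.1 = y.1)
    obtain rfl : c = d := Subtype.ext (s.eq_of_mem_classes c.2 x.2 d.2 (hxy ▸ y.2))
    rw [Subtype.ext hxy]
  · exact ⟨⟨⟨_, s.mem_classes a⟩, a, s.refl' a⟩, rfl⟩

end Glue

/-- A finite NBC edge set is a forest, so it has as many edges as vertices minus components. -/
theorem isNBC.card_add_ncard_classes [Fintype V] [IsLinearOrder (Sym2 V) le] (h : isNBC G le F)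
    (hF : (F : Set (Sym2 V)) ⊆ G.edgeSet) :
    F.card + (fromEdgeSet (F : Set (Sym2 V))).reachableSetoid.classes.ncard = Fintype.card V := by
  classical
  let e := nbcForestEquiv G le (fromEdgeSet (F : Set (Sym2 V))).reachableSetoid
  have hglue := congrArg Subtype.val (e.symm_apply_apply ⟨F, hF, h, rfl⟩)
  have := card_glueEdges_add_card fun c => (e ⟨F, hF, h, rfl⟩ c).2.1
  rw [← Nat.card_coe_set_eq, Nat.card_eq_fintype_card, ← this]
  exact congrArg (Finset.card · + _) hglue.symm

end NBC

instance {α : Type} [Finite α] : Finite (Setoid α) :=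
  Finite.of_injective (fun s : Setoid α => s.r) fun _ _ h => Setoid.ext fun a b => by
    exact iff_of_eq (congrFun₂ h a b)

section BondLattice

variable {m : ℕ} (G : SimpleGraph (Fin m))

noncomputable instance : Fintype (BondLattice G) := Fintype.ofFinite _

/-- The bond partition of `G` into the connected components of its subgraph with edges in `F`. -/
def bondOf (F : Finset (Sym2 (Fin m))) : BondLattice G :=
  ⟨(fromEdgeSet (F : Set (Sym2 (Fin m))) ⊓ G).reachableSetoid, fun _ hc =>
    (connected_induce_of_mem_classes hc).mono fun _ _ h => And.right h⟩

variable {G}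

theorem bondOf_eq {F : Finset (Sym2 (Fin m))} (hF : (F : Set (Sym2 (Fin m))) ⊆ G.edgeSet) :
    (bondOf G F).1 = (fromEdgeSet (F : Set (Sym2 (Fin m)))).reachableSetoid := by
  have h : fromEdgeSet (F : Set (Sym2 (Fin m))) ⊓ G = fromEdgeSet (F : Set (Sym2 (Fin m))) :=
    inf_eq_left.2 fun _ _ hab => hF ((fromEdgeSet_adj _).1 hab).1
  change (fromEdgeSet (F : Set (Sym2 (Fin m))) ⊓ G).reachableSetoid = _
  rw [h]

theorem bondOf_le_iff {F : Finset (Sym2 (Fin m))} (hF : (F : Set (Sym2 (Fin m))) ⊆ G.edgeSet)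
    (y : BondLattice G) : bondOf G F ≤ y ↔ ∀ a b, s(a, b) ∈ F → y.1 a b := by
  rw [← Subtype.coe_le_coe, bondOf_eq hF]
  refine ⟨fun h a b hab => h ?_, fun h a b => rel_of_reachable fun x y hxy => ?_⟩
  · exact Adj.reachable ((fromEdgeSet_adj _).2 ⟨hab, (hF hab : G.Adj a b).ne⟩)
  · exact h x y ((fromEdgeSet_adj _).1 hxy).1

/-- Two related distinct vertices of a bond partition force an edge between related vertices. -/
theorem exists_adj_of_rel {y : BondLattice G} {a b : Fin m} (hab : y.1 a b) (hne : a ≠ b) :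
    ∃ u v, G.Adj u v ∧ y.1 u v := by
  obtain ⟨c, hc, ha, hb⟩ := y.1.rel_iff_exists_classes.1 hab
  have : Nontrivial c := ⟨⟨a, ha⟩, ⟨b, hb⟩, fun h => hne (congrArg Subtype.val h)⟩
  obtain ⟨v, hv⟩ := (y.2 c hc).preconnected.exists_adj_of_nontrivial ⟨a, ha⟩
  exact ⟨a, v, hv, y.1.rel_iff_exists_classes.2 ⟨c, hc, ha, v.2⟩⟩

variable (G)

/-- The signed number of NBC edge sets whose components are the blocks of `z`. -/
noncomputable def signedNBCCount (le : Sym2 (Fin m) → Sym2 (Fin m) → Prop)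
    (z : BondLattice G) : ℤ :=
  (-1) ^ (m - z.1.classes.ncard) *
    ∏ᶠ c ∈ z.1.classes,
      (a1 (G.induce c) (fun e f => le (e.map Subtype.val) (f.map Subtype.val)) : ℤ)

variable {G} {le : Sym2 (Fin m) → Sym2 (Fin m) → Prop} [IsLinearOrder (Sym2 (Fin m)) le]

open Classical in
theorem signedNBCCount_eq_sum (z : BondLattice G) :
    signedNBCCount G le z =
      ∑ F ∈ Finset.univ.filter fun F : Finset (Sym2 (Fin m)) =>
        ((F : Set (Sym2 (Fin m))) ⊆ G.edgeSet ∧ isNBC G le F) ∧ bondOf G F = z, (-1) ^ F.card := by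
  have hcard : ∀ F ∈ Finset.univ.filter fun F : Finset (Sym2 (Fin m)) =>
      ((F : Set (Sym2 (Fin m))) ⊆ G.edgeSet ∧ isNBC G le F) ∧ bondOf G F = z,
      (-1 : ℤ) ^ F.card = (-1) ^ (m - z.1.classes.ncard) := by
    intro F hF
    obtain ⟨⟨hFG, hnbc⟩, rfl⟩ := (Finset.mem_filter.1 hF).2
    have := hnbc.card_add_ncard_classes hFG
    rw [Fintype.card_fin] at this
    rw [bondOf_eq hFG, Nat.eq_sub_of_add_eq this]
  rw [Finset.sum_congr rfl hcard, Finset.sum_const, nsmul_eq_mul, mul_comm, signedNBCCount,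
    ← finprod_set_coe_eq_finprod_mem, finprod_eq_prod_of_fintype]
  congr 1
  have := Nat.card_congr (nbcForestEquiv G le z.1)
  rw [Nat.card_pi] at this
  simp only [a1]
  rw [← Nat.cast_prod, ← this, Nat.card_eq_fintype_card, Fintype.card_subtype]
  congr 2
  refine Finset.filter_congr fun F _ => ?_
  rw [← and_assoc]
  exact and_congr_right fun h => by rw [← bondOf_eq h.1, Subtype.ext_iff]

open Classical in
theorem sum_signedNBCCount (y : BondLattice G) :
    ∑ z : BondLattice G with z ≤ y, signedNBCCount G le z =
      if ∀ a b, y.1 a b → a = b then 1 else 0 := by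
  let E : Finset (Sym2 (Fin m)) :=
    {e | e ∈ G.edgeSet ∧ e ∈ Sym2.fromRel (r := y.1) ⟨fun _ _ => y.1.symm'⟩}
  have hE : ∀ a b, s(a, b) ∈ E ↔ G.Adj a b ∧ y.1 a b := fun a b => by simp [E]
  have hsum : ∑ z : BondLattice G with z ≤ y, signedNBCCount G le z =
      ∑ F ∈ E.powerset with isNBC G le F, (-1) ^ F.card := by
    have hfil : ∀ F : Finset (Sym2 (Fin m)), (F ⊆ E ∧ isNBC G le F) ↔
        ((F : Set (Sym2 (Fin m))) ⊆ G.edgeSet ∧ isNBC G le F) ∧ bondOf G F ≤ y := by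
      intro F
      rw [and_right_comm]
      refine and_congr_left fun _ => ⟨fun h => ?_, fun ⟨h, h'⟩ e he => ?_⟩
      · have hFG : (F : Set (Sym2 (Fin m))) ⊆ G.edgeSet := fun e he =>
          (Finset.mem_filter.1 (h he)).2.1
        exact ⟨hFG, (bondOf_le_iff hFG y).2 fun a b hab => ((hE a b).1 (h hab)).2⟩
      · induction e with
        | h a b => exact (hE a b).2 ⟨h he, (bondOf_le_iff h y).1 h' a b he⟩
    rw [← Finset.sum_fiberwise_of_maps_to (g := bondOf G)
      (t := ({z | z ≤ y} : Finset (BondLattice G)))]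
    · refine Finset.sum_congr rfl fun z hz => ?_
      rw [signedNBCCount_eq_sum]
      refine Finset.sum_congr ?_ fun _ _ => rfl
      ext F
      simp only [Finset.mem_filter, Finset.mem_univ, true_and, Finset.mem_powerset, hfil] at hz ⊢
      exact ⟨fun h => ⟨⟨h.1, h.2 ▸ hz⟩, h.2⟩, fun h => ⟨h.1.1, h.2⟩⟩
    · intro F hF
      rw [Finset.mem_filter, Finset.mem_powerset, hfil] at hF
      simpa using hF.2
  rw [hsum]
  split_ifs with h
  · have hempty : E = ∅ := Finset.eq_empty_of_forall_notMem fun e he => by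
      induction e with
      | h a b => exact ((hE a b).1 he).1.ne (h a b ((hE a b).1 he).2)
    rw [hempty, Finset.powerset_empty, Finset.filter_singleton, if_pos isNBC_empty,
      Finset.sum_singleton, Finset.card_empty, pow_zero]
  · push Not at h
    obtain ⟨a, b, hab, hne⟩ := h
    obtain ⟨u, v, huv⟩ := exists_adj_of_rel hab hne
    exact sum_neg_one_pow_card_isNBC hE ⟨_, (hE u v).2 huv⟩

end BondLattice

theorem stmt9 (m : ℕ) (G : SimpleGraph (Fin m)) (eo : LinearOrder (Sym2 (Fin m)))
    (μ : BondLattice G → BondLattice G → ℤ)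
    -- `μ` is the Möbius function of the bond lattice:
    (hμrefl : ∀ x : BondLattice G, μ x x = 1)
    (hμrec : ∀ x y : BondLattice G, x < y → ∑ᶠ z ∈ Set.Icc x y, μ x z = 0)
    -- `bot` is the bottom element (the partition into singletons):
    (bot : BondLattice G) (hbot : ∀ a b : Fin m, bot.1.r a b ↔ a = b)
    (B : BondLattice G) :
    μ bot B = (-1) ^ (m - B.1.classes.ncard) *
      ∏ᶠ c ∈ B.1.classes,
        (a1 (G.induce c)
          (fun e f => eo.le (e.map Subtype.val) (f.map Subtype.val)) : ℤ) := by
  classical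
  have hlin : IsLinearOrder (Sym2 (Fin m)) eo.le :=
    { refl := eo.le_refl, trans := eo.le_trans, antisymm := eo.le_antisymm, total := eo.le_total }
  have hbot_le : ∀ z, bot ≤ z := fun z a b hab => (hbot a b).1 hab ▸ z.1.refl' a
  have hIcc : ∀ y, Set.Icc bot y = (({z | z ≤ y} : Finset (BondLattice G)) : Set (BondLattice G)) :=
    fun y => by ext z; simp [hbot_le]
  suffices ∀ y, μ bot y = signedNBCCount G eo.le y from this B
  intro y
  induction y using WellFoundedLT.induction with
  | ind y ih =>
    have hsum : ∑ z with z ≤ y, μ bot z = ∑ z with z ≤ y, signedNBCCount G eo.le z := by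
      rw [sum_signedNBCCount]
      obtain rfl | hlt := (hbot_le y).eq_or_lt
      · rw [if_pos fun a b => (hbot a b).1]
        have : ({z | z ≤ bot} : Finset (BondLattice G)) = {bot} := by
          ext z
          simpa using ⟨fun h => le_antisymm h (hbot_le z), fun h => h.le⟩
        rw [this, Finset.sum_singleton, hμrefl]
      · rw [if_neg fun h => hlt.not_ge fun a b hab => (hbot a b).2 (h a b hab),
          ← hμrec bot y hlt, hIcc, finsum_mem_coe_finset]
    have hmem : y ∈ ({z | z ≤ y} : Finset (BondLattice G)) := by simp
    rw [← Finset.sum_erase_add _ _ hmem, ← Finset.sum_erase_add _ _ hmem] at hsum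
    have herase : ∀ z ∈ ({z | z ≤ y} : Finset (BondLattice G)).erase y,
        μ bot z = signedNBCCount G eo.le z := fun z hz => by
      rw [Finset.mem_erase, Finset.mem_filter] at hz
      exact ih z (hz.2.2.lt_of_ne hz.1)
    rw [Finset.sum_congr rfl herase] at hsum
    exact add_left_cancel hsum
end

section
/- Let Γ be a finite simple graph on vertex set {1,…,m} whose edges carry the NBC order. Then every increasing forest of Γ is NBC, i.e. contains no broken circuit of Γ. -/
/-- An acyclic set of edges of `H`. -/
def isForestIn {W : Type} (H : SimpleGraph W) (F : Finset (Sym2 W)) : Prop :=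
  (↑F : Set (Sym2 W)) ⊆ H.edgeSet ∧
    (SimpleGraph.fromEdgeSet (↑F : Set (Sym2 W))).IsAcyclic

/-- The sum of the two endpoints of an unordered pair. -/
def sumOf {m : ℕ} (e : Sym2 (Fin m)) : ℕ :=
  Sym2.lift ⟨fun (i j : Fin m) => (i : ℕ) + (j : ℕ), fun i j => Nat.add_comm i j⟩ e

/-- The larger endpoint of an unordered pair. -/
def maxOf {m : ℕ} (e : Sym2 (Fin m)) : ℕ :=
  Sym2.lift ⟨fun (i j : Fin m) => max (i : ℕ) (j : ℕ), fun i j => max_comm (i : ℕ) (j : ℕ)⟩ e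

/-- The NBC order on edges over `{1,…,m}`: writing an edge as `{i,j}` with
`i < j`, one has `{i,j} ≤ {i',j'}` iff `i+j > i'+j'`, or `i+j = i'+j'` and
`j ≥ j'`. -/
def nbcLE {m : ℕ} (e f : Sym2 (Fin m)) : Prop :=
  sumOf f < sumOf e ∨ (sumOf f = sumOf e ∧ maxOf f ≤ maxOf e)

/-- A forest is increasing if in each of its component trees, rooted at its least
vertex, the vertex labels strictly increase along every path from the root. -/
def isIncreasingForest {m : ℕ} (F : Finset (Sym2 (Fin m))) : Prop :=
  ∀ (r v : Fin m) (p : (SimpleGraph.fromEdgeSet (↑F : Set (Sym2 (Fin m)))).Walk r v),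
    p.IsPath →
    (∀ u, (SimpleGraph.fromEdgeSet (↑F : Set (Sym2 (Fin m)))).Reachable r u → r ≤ u) →
    List.Chain' (· < ·) p.support

/-- A vertex of an increasing forest has at most one neighbor with a smaller label. -/
theorem isIncreasingForest.eq_of_adj_of_lt {m : ℕ} {F : Finset (Sym2 (Fin m))}
    (hinc : isIncreasingForest F)
    (hac : (SimpleGraph.fromEdgeSet (↑F : Set (Sym2 (Fin m)))).IsAcyclic) {u v w : Fin m}
    (hu : (SimpleGraph.fromEdgeSet (↑F : Set (Sym2 (Fin m)))).Adj u w)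
    (hv : (SimpleGraph.fromEdgeSet (↑F : Set (Sym2 (Fin m)))).Adj v w)
    (huw : u < w) (hvw : v < w) : u = v := by
  set H := SimpleGraph.fromEdgeSet (↑F : Set (Sym2 (Fin m)))
  obtain ⟨r, hr, hmin⟩ := Set.exists_min_image {r | H.Reachable r w} id (Set.toFinite _)
    ⟨w, SimpleGraph.Reachable.refl w⟩
  have hroot : ∀ t, H.Reachable r t → r ≤ t := fun t ht => hmin t (ht.symm.trans hr)
  have extend : ∀ t, H.Adj t w → t < w →
      ∃ p : H.Walk r w, p.IsPath ∧ p.penultimate = t := by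
    intro t ht htw
    obtain ⟨p, hp⟩ := (hr.trans ht.symm.reachable).exists_isPath
    have hsorted : p.support.SortedLT := List.IsChain.sortedLT (hinc r t p hp hroot)
    have hle : ∀ x ∈ p.support, x ≤ t := by
      intro x hx
      have h := hsorted.pairwise
      rw [← List.dropLast_append_getLast p.support_ne_nil, p.getLast_support,
        List.pairwise_append] at h
      rw [← List.dropLast_append_getLast p.support_ne_nil, p.getLast_support] at hx
      rcases List.mem_append.1 hx with hx | hx
      · exact (h.2.2 x hx t (by simp)).le
      · exact (List.mem_singleton.1 hx).le
    exact ⟨p.concat ht, hp.concat (fun h => (hle w h).not_gt htw) ht, by simp⟩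
  obtain ⟨p, hp, hpu⟩ := extend u hu huw
  obtain ⟨q, hq, hqv⟩ := extend v hv hvw
  have hpq : p = q := congrArg Subtype.val ((hac.subsingleton_path r w).elim ⟨p, hp⟩ ⟨q, hq⟩)
  rw [← hpu, ← hqv, hpq]

/-- If every vertex of `H` has at most one smaller neighbor, a path that avoids a smaller neighbor
of its starting vertex ends at a vertex that is at least its starting vertex. -/
theorem SimpleGraph.Walk.IsPath.start_le_end_of_adj_lt {V : Type*} [LinearOrder V]
    {H : SimpleGraph V} (hH : ∀ u v w, H.Adj u w → H.Adj v w → u < w → v < w → u = v)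
    {a x b : V} (p : H.Walk x b) (hp : p.IsPath) (hax : H.Adj a x) (hlt : a < x)
    (ha : a ∉ p.support) : x ≤ b := by
  induction p generalizing a with
  | nil => exact le_rfl
  | @cons x y b h q ih =>
    rw [SimpleGraph.Walk.cons_isPath_iff] at hp
    have hxy : x < y := by
      refine lt_of_le_of_ne (not_lt.1 fun hyx => ha ?_) h.ne
      rw [hH a y x hax h.symm hlt hyx]
      simp
    exact hxy.le.trans (ih hp.1 h hxy hp.2)

/-- Removing an edge from a cycle leaves its endpoints connected by the remaining edges. -/
theorem isCycleEdges.reachable_erase {W : Type} [DecidableEq W] {H : SimpleGraph W}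
    {C : Finset (Sym2 W)} (hC : isCycleEdges H C) {a b : W} (hab : s(a, b) ∈ C) :
    (SimpleGraph.fromEdgeSet (↑(C.erase s(a, b)) : Set (Sym2 W))).Reachable a b := by
  obtain ⟨v, w, hw, rfl⟩ := hC
  set K := SimpleGraph.fromEdgeSet (↑w.edges.toFinset : Set (Sym2 W)) with hK
  have hedges : ∀ e ∈ w.edges, e ∈ K.edgeSet := by
    intro e he
    rw [hK, SimpleGraph.edgeSet_fromEdgeSet]
    exact ⟨by simpa using he, H.not_isDiag_of_mem_edgeSet (w.edges_subset_edgeSet he)⟩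
  have hmem : s(a, b) ∈ w.edges := by simpa using hab
  have h := (SimpleGraph.adj_and_reachable_delete_edges_iff_exists_cycle (G := K)).2
    ⟨v, w.transfer K hedges, hw.transfer hedges, by simpa using hmem⟩
  refine h.2.mono fun x y hxy => ?_
  simp only [hK, SimpleGraph.fromEdgeSet_adj, SimpleGraph.deleteEdges_adj, Finset.mem_coe,
    Finset.mem_erase, Set.mem_singleton_iff] at hxy ⊢
  tauto

theorem stmt11 (m : ℕ) (G : SimpleGraph (Fin m)) (F : Finset (Sym2 (Fin m)))
    (hF : isForestIn G F) (hinc : isIncreasingForest F) :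
    isNBC G nbcLE F := by
  rintro B ⟨C, e, hC, he, hmax, rfl⟩ hsub
  have key : ∀ a b : Fin m, a < b → e = s(a, b) → False := by
    rintro a b hab rfl
    have hunique := fun u v w => hinc.eq_of_adj_of_lt hF.2 (u := u) (v := v) (w := w)
    have hle : SimpleGraph.fromEdgeSet (↑(C.erase s(a, b)) : Set (Sym2 (Fin m))) ≤
        SimpleGraph.fromEdgeSet (↑F : Set (Sym2 (Fin m))) :=
      SimpleGraph.fromEdgeSet_mono (by exact_mod_cast hsub)
    obtain ⟨p, hp⟩ := (hC.reachable_erase he).exists_isPath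
    cases p with
    | nil => exact hab.false
    | @cons _ x _ h q =>
      rw [SimpleGraph.Walk.cons_isPath_iff] at hp
      have hx := (SimpleGraph.fromEdgeSet_adj _).1 h
      rw [Finset.mem_coe, Finset.mem_erase] at hx
      have hxb : x ≠ b := fun hxb => hx.1.1 (by rw [hxb])
      have hxle : x ≤ b := by
        rcases lt_or_ge a x with hax | hxa
        · exact SimpleGraph.Walk.IsPath.start_le_end_of_adj_lt hunique (q.mapLe hle)
            (hp.1.mapLe hle) (hle h) hax (by simpa using hp.2)
        · exact hxa.trans hab.le
      have hord := hmax _ hx.1.2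
      simp only [nbcLE, sumOf, Sym2.lift_mk] at hord
      omega
  induction e using Sym2.ind with
  | _ a b =>
    obtain ⟨v, w, -, rfl⟩ := hC
    have hne : a ≠ b := (w.adj_of_mem_edges (by simpa using he)).ne
    rcases hne.lt_or_gt with h | h
    · exact key a b h rfl
    · exact key b a h Sym2.eq_swap
end

section
/- Let K_m be the complete graph on vertex set {1,…,m} with the NBC order on its edges. Then a tree in K_m (an acyclic connected subgraph) contains no broken circuit of K_m if and only if it is increasing. -/
/-- The set of vertices incident to at least one edge of `T`. -/
def edgeVerts {m : ℕ} (T : Finset (Sym2 (Fin m))) : Set (Fin m) :=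
  {v | ∃ e ∈ T, v ∈ e}

/-- `T` is (the edge set of) a tree in `H`: an acyclic connected subgraph. -/
def isTreeIn {m : ℕ} (H : SimpleGraph (Fin m)) (T : Finset (Sym2 (Fin m))) : Prop :=
  (↑T : Set (Sym2 (Fin m))) ⊆ H.edgeSet ∧
    (SimpleGraph.fromEdgeSet (↑T : Set (Sym2 (Fin m)))).IsAcyclic ∧
    ∀ u ∈ edgeVerts T, ∀ v ∈ edgeVerts T,
      (SimpleGraph.fromEdgeSet (↑T : Set (Sym2 (Fin m)))).Reachable u v

/-- A tree is increasing if, rooted at its least vertex, the vertex labels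
strictly increase along every path from the root. -/
def isIncreasingTree {m : ℕ} (T : Finset (Sym2 (Fin m))) : Prop :=
  ∀ (r v : Fin m) (p : (SimpleGraph.fromEdgeSet (↑T : Set (Sym2 (Fin m)))).Walk r v),
    p.IsPath → r ∈ edgeVerts T → (∀ u ∈ edgeVerts T, r ≤ u) →
    List.Chain' (· < ·) p.support

theorem sumOf_mk {m : ℕ} (a b : Fin m) : sumOf s(a, b) = (a : ℕ) + b := rfl

theorem sumOf_le_of_nbcLE {m : ℕ} {e f : Sym2 (Fin m)} (h : nbcLE e f) :
    sumOf f ≤ sumOf e := by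
  rcases h with h | h
  · exact h.le
  · exact h.1.le

theorem isChain_support_concat_iff {m : ℕ} {G : SimpleGraph (Fin m)} {a b c : Fin m}
    (p : G.Walk a b) (h : G.Adj b c) :
    List.IsChain (· < ·) (p.concat h).support ↔ List.IsChain (· < ·) p.support ∧ b < c := by
  rw [SimpleGraph.Walk.support_concat, List.isChain_append]
  simp [List.getLast?_eq_getLast_of_ne_nil p.support_ne_nil]

theorem le_of_mem_support_of_isChain {m : ℕ} {G : SimpleGraph (Fin m)} {a b : Fin m}
    (p : G.Walk a b) (hp : List.IsChain (· < ·) p.support) :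
    ∀ x ∈ p.support, a ≤ x ∧ x ≤ b := by
  induction p with
  | nil => simp
  | cons h q ih =>
    rw [SimpleGraph.Walk.support_cons] at hp
    have hq := hp.of_cons
    have hlt := hp.rel_cons (q.start_mem_support)
    intro x hx
    rw [SimpleGraph.Walk.support_cons, List.mem_cons] at hx
    rcases hx with rfl | hx
    · exact ⟨le_rfl, hlt.le.trans (ih hq _ q.start_mem_support).2⟩
    · exact ⟨hlt.le.trans (ih hq x hx).1, (ih hq x hx).2⟩

/-- A path that increases from `a` to `b` and then steps to a vertex `c` above `a`
does not descend, provided its edges lie in an NBC set. -/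
theorem isNBC.lt_of_isChain_support {m : ℕ} {T : Finset (Sym2 (Fin m))}
    (hN : isNBC (⊤ : SimpleGraph (Fin m)) nbcLE T) {a b c : Fin m}
    (p : (SimpleGraph.fromEdgeSet (↑T : Set (Sym2 (Fin m)))).Walk a b)
    (h : (SimpleGraph.fromEdgeSet (↑T : Set (Sym2 (Fin m)))).Adj b c)
    (hp : List.IsChain (· < ·) p.support) (hpath : (p.concat h).IsPath) (hac : a < c) :
    b < c := by
  induction p with
  | nil => exact hac
  | @cons a a' b hadj q ih =>
    rw [SimpleGraph.Walk.concat_cons] at hpath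
    rw [SimpleGraph.Walk.support_cons] at hp
    have hq := hp.of_cons
    have haa' := hp.rel_cons (q.start_mem_support)
    have hqpath := hpath.of_cons
    rcases lt_or_ge a' c with hlt | hge
    · exact ih h hq hqpath hlt
    exfalso
    have hne : a' ≠ c := by
      rintro rfl
      exact ((SimpleGraph.Walk.concat_isPath_iff h).1 hqpath).2 q.start_mem_support
    have hca' : c < a' := lt_of_le_of_ne hge hne.symm
    have hbound := le_of_mem_support_of_isChain q hq
    have hsum : ∀ f ∈ (SimpleGraph.Walk.cons hadj (q.concat h)).edges,
        sumOf s(c, a) < sumOf f := by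
      intro f hf
      rw [SimpleGraph.Walk.edges_cons, SimpleGraph.Walk.edges_concat, List.concat_eq_append,
        List.mem_cons, List.mem_append, List.mem_singleton] at hf
      rcases hf with rfl | hf | rfl
      · simp only [sumOf_mk]; omega
      · induction f using Sym2.ind with
        | _ x y =>
          have hx := (hbound x (q.fst_mem_support_of_mem_edges hf)).1
          have hy := (hbound y (q.snd_mem_support_of_mem_edges hf)).1
          simp only [sumOf_mk]; omega
      · have hb := (hbound _ q.end_mem_support).1
        simp only [sumOf_mk]; omega
    set W := SimpleGraph.Walk.cons hadj (q.concat h) with hW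
    have hcyc : (SimpleGraph.Walk.cons (show (⊤ : SimpleGraph (Fin m)).Adj c a from hac.ne')
        (W.mapLe le_top)).IsCycle := by
      rw [SimpleGraph.Walk.cons_isCycle_iff]
      refine ⟨hpath.mapLe _, fun hmem => ?_⟩
      rw [SimpleGraph.Walk.edges_mapLe_eq_edges] at hmem
      exact (hsum _ hmem).false
    refine hN _ ⟨_, s(c, a), ⟨_, _, hcyc, rfl⟩, by simp, ?_, rfl⟩ ?_
    · intro f hf
      rw [List.mem_toFinset, SimpleGraph.Walk.edges_cons, List.mem_cons,
        SimpleGraph.Walk.edges_mapLe_eq_edges] at hf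
      rcases hf with rfl | hf
      · exact Or.inr ⟨rfl, le_rfl⟩
      · exact Or.inl (hsum f hf)
    · intro f hf
      rw [Finset.mem_erase, List.mem_toFinset, SimpleGraph.Walk.edges_cons, List.mem_cons,
        SimpleGraph.Walk.edges_mapLe_eq_edges] at hf
      have hfW := W.edges_subset_edgeSet (hf.2.resolve_left hf.1)
      rw [SimpleGraph.edgeSet_fromEdgeSet] at hfW
      exact hfW.1

theorem isNBC.isIncreasingTree {m : ℕ} {T : Finset (Sym2 (Fin m))}
    (hN : isNBC (⊤ : SimpleGraph (Fin m)) nbcLE T) : isIncreasingTree T := by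
  intro r v p hp _ hmin
  change List.IsChain (· < ·) p.support
  induction p using SimpleGraph.Walk.concatRec with
  | Hnil => simp
  | @Hconcat r b c q h ih =>
    obtain ⟨hq, hcq⟩ := (SimpleGraph.Walk.concat_isPath_iff h).1 hp
    have hchain := ih hq ‹_› hmin
    refine (isChain_support_concat_iff q h).2 ⟨hchain, ?_⟩
    refine hN.lt_of_isChain_support q h hchain hp (lt_of_le_of_ne ?_ ?_)
    · exact hmin c ⟨s(b, c), ((SimpleGraph.fromEdgeSet_adj _).1 h).1, by simp⟩
    · rintro rfl
      exact hcq q.start_mem_support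

/-- A vertex of an increasing tree has at most one smaller neighbour. -/
theorem isIncreasingTree.eq_of_mem_of_mem {m : ℕ} {T : Finset (Sym2 (Fin m))}
    (hT : isTreeIn (⊤ : SimpleGraph (Fin m)) T) (hI : isIncreasingTree T) {z a b : Fin m}
    (ha : s(a, z) ∈ T) (hb : s(b, z) ∈ T) (haz : a < z) (hbz : b < z) : a = b := by
  obtain ⟨-, hacyc, hconn⟩ := hT
  have hav : a ∈ edgeVerts T := ⟨_, ha, by simp⟩
  have hbv : b ∈ edgeVerts T := ⟨_, hb, by simp⟩
  obtain ⟨r, hr, hmin⟩ := Set.exists_min_image (edgeVerts T) id (Set.toFinite _) ⟨a, hav⟩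
  have key : ∀ x, s(x, z) ∈ T → x < z → x ∈ edgeVerts T →
      ∃ p : (SimpleGraph.fromEdgeSet (↑T : Set (Sym2 (Fin m)))).Walk r z,
        p.IsPath ∧ p.penultimate = x := by
    intro x hx hxz hxv
    obtain ⟨p, hp⟩ := (hconn r hr x hxv).exists_isPath
    have hchain : List.IsChain (· < ·) p.support := hI r x p hp hr hmin
    have hadj : (SimpleGraph.fromEdgeSet (↑T : Set (Sym2 (Fin m)))).Adj x z :=
      (SimpleGraph.fromEdgeSet_adj _).2 ⟨hx, hxz.ne⟩
    refine ⟨p.concat hadj, hp.concat (fun hz => ?_) hadj, by simp⟩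
    exact (le_of_mem_support_of_isChain p hchain z hz).2.not_gt hxz
  obtain ⟨p, hp, rfl⟩ := key a ha haz hav
  obtain ⟨q, hq, rfl⟩ := key b hb hbz hbv
  have := hacyc.subsingleton_path r z
  have hpq : p = q := congrArg Subtype.val
    (Subsingleton.elim (⟨p, hp⟩ : SimpleGraph.Path _ r z) ⟨q, hq⟩)
  rw [hpq]

theorem SimpleGraph.Walk.IsCycle.exists_mem_edges_snd {V : Type*} {G : SimpleGraph V} {z : V}
    {w : G.Walk z z} (hw : w.IsCycle) : ∃ p, p ≠ z ∧ s(w.snd, p) ∈ w.edges := by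
  cases w with
  | nil => simp at hw
  | cons h q =>
    cases q with
    | nil => exact absurd rfl h.ne
    | @cons _ y _ h' q =>
      refine ⟨y, ?_, by simp⟩
      rintro rfl
      rw [SimpleGraph.Walk.cons_isCycle_iff] at hw
      exact hw.2 (by simp [Sym2.eq_swap])

/-- At the largest vertex of a cycle, the first edge is not the greatest in the NBC order. -/
theorem SimpleGraph.Walk.IsCycle.ne_of_forall_nbcLE {m : ℕ} {G : SimpleGraph (Fin m)} {z : Fin m}
    {w : G.Walk z z} (hw : w.IsCycle) (hz : ∀ x ∈ w.support, x ≤ z) {e : Sym2 (Fin m)}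
    (he : ∀ f ∈ w.edges, nbcLE f e) : s(w.snd, z) ≠ e := by
  rintro rfl
  obtain ⟨p, hpz, hp⟩ := hw.exists_mem_edges_snd
  have hle := sumOf_le_of_nbcLE (he _ hp)
  have hlt := lt_of_le_of_ne (hz p (w.snd_mem_support_of_mem_edges hp)) hpz
  simp only [sumOf_mk] at hle
  omega

theorem isIncreasingTree.isNBC {m : ℕ} {T : Finset (Sym2 (Fin m))}
    (hT : isTreeIn (⊤ : SimpleGraph (Fin m)) T) (hI : isIncreasingTree T) :
    isNBC (⊤ : SimpleGraph (Fin m)) nbcLE T := by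
  rintro _ ⟨_, e, ⟨v, w₀, hw₀, rfl⟩, -, hmax, rfl⟩ hsub
  obtain ⟨z, hz, hzmax⟩ := w₀.support.toFinset.exists_max_image id ⟨v, by simp⟩
  rw [List.mem_toFinset] at hz
  set w := w₀.rotate z hz with hwdef
  have hw : w.IsCycle := hw₀.rotate hz
  have hedges : ∀ f, f ∈ w.edges ↔ f ∈ w₀.edges := fun f => (w₀.rotate_edges z hz).mem_iff
  have hle : ∀ x ∈ w.support, x ≤ z := by
    intro x hx
    exact hzmax x (by simpa [hwdef] using hx)
  have he : ∀ f ∈ w.edges, nbcLE f e := fun f hf =>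
    hmax f (List.mem_toFinset.2 ((hedges f).1 hf))
  have hmem : ∀ f ∈ w.edges, f ≠ e → f ∈ T := fun f hf hne =>
    hsub (Finset.mem_erase.2 ⟨hne, List.mem_toFinset.2 ((hedges f).1 hf)⟩)
  have key : ∀ u : (⊤ : SimpleGraph (Fin m)).Walk z z, u.IsCycle →
      (∀ f, f ∈ u.edges → f ∈ w.edges) → (∀ x ∈ u.support, x ≤ z) →
      s(u.snd, z) ∈ T ∧ u.snd < z := by
    intro u hu hsubu hleu
    have hadj := u.adj_snd hu.not_nil
    have hin : s(u.snd, z) ∈ u.edges := by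
      rw [Sym2.eq_swap]
      exact u.mk_start_snd_mem_edges hu.not_nil
    exact ⟨hmem _ (hsubu _ hin) (hu.ne_of_forall_nbcLE hleu fun f hf => he f (hsubu f hf)),
      lt_of_le_of_ne (hleu _ (u.fst_mem_support_of_mem_edges hin)) hadj.ne'⟩
  obtain ⟨h₁, h₁'⟩ := key w hw (fun _ h => h) hle
  obtain ⟨h₂, h₂'⟩ := key w.reverse hw.reverse (by simp) (by simpa using hle)
  have := hI.eq_of_mem_of_mem hT h₁ h₂ h₁' h₂'
  rw [SimpleGraph.Walk.snd_reverse] at this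
  exact hw.snd_ne_penultimate this

theorem stmt12 (m : ℕ) (T : Finset (Sym2 (Fin m)))
    (hT : isTreeIn (⊤ : SimpleGraph (Fin m)) T) :
    isNBC (⊤ : SimpleGraph (Fin m)) nbcLE T ↔ isIncreasingTree T :=
  ⟨fun hN => hN.isIncreasingTree, fun hI => hI.isNBC hT⟩
end
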